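/- arXiv:2111.11801 — 2 statements merged into one kernel-verified Lean document; each statement's English description precedes it below -/
import Mathlib

section
/- Let X ∈ ℝ^{n×p}, y ∈ ℝⁿ, λ > 0, and let q: ℝ^p → ℝ be convex and differentiable, with f(β) = (1/2)‖Xβ − y‖² + λ‖β‖₁ − q(β) bounded below on ℝ^p. Let (σ^{2,k})_{k≥0} be positive reals, and let (β^k)_{k≥0}, (δ^k)_{k≥0} in ℝ^p be such that for every k, β^{k+1} is a global minimizer of β ↦ J_k(β) + ⟨δ^k, β − β^k⟩, where J_k(β) = (1/2)‖Xβ − y‖² + λ‖β‖₁ − q(β^k) − ⟨∇q(β^k), β − β^k⟩ + (σ^{2,k}/2)‖β − β^k‖², and ‖δ^k‖ ≤ (σ^{2,k}/4)‖β^{k+1} − β^k‖. Then for every k, f(β^k) ≥ f(β^{k+1}) + (σ^{2,k}/4)‖β^{k+1} − β^k‖². -/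
/-- Euclidean norm on `Fin m → ℝ`. -/
noncomputable def euclNorm {m : ℕ} (x : Fin m → ℝ) : ℝ := Real.sqrt (∑ i, (x i) ^ 2)

/-- ℓ₁ norm on `Fin m → ℝ`. -/
noncomputable def l1Norm {m : ℕ} (x : Fin m → ℝ) : ℝ := ∑ i, |x i|

/-- Euclidean inner product on `Fin m → ℝ`. -/
noncomputable def dotp {m : ℕ} (x y : Fin m → ℝ) : ℝ := ∑ i, x i * y i

/-- The continuous linear functional `v ↦ ⟨g, v⟩` on `Fin m → ℝ`. -/
noncomputable def dotCLM {m : ℕ} (g : Fin m → ℝ) : (Fin m → ℝ) →L[ℝ] ℝ :=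
  ∑ i, g i • ContinuousLinearMap.proj i

/-- The objective `f(β) = (1/2)‖Xβ − y‖² + λ‖β‖₁ − q(β)`. -/
noncomputable def fObj {n p : ℕ} (X : Matrix (Fin n) (Fin p) ℝ) (y : Fin n → ℝ)
    (lam : ℝ) (q : (Fin p → ℝ) → ℝ) (β : Fin p → ℝ) : ℝ :=
  (1 / 2) * (euclNorm (X.mulVec β - y)) ^ 2 + lam * l1Norm β - q β

/-- The majorization `J_k(β) = (1/2)‖Xβ − y‖² + λ‖β‖₁ − q(β^k) − ⟨∇q(β^k), β − β^k⟩
+ (σ^{2,k}/2)‖β − β^k‖²`. -/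
noncomputable def Jmaj {n p : ℕ} (X : Matrix (Fin n) (Fin p) ℝ) (y : Fin n → ℝ)
    (lam sigma : ℝ) (q : (Fin p → ℝ) → ℝ) (g : (Fin p → ℝ) → (Fin p → ℝ))
    (βk β : Fin p → ℝ) : ℝ :=
  (1 / 2) * (euclNorm (X.mulVec β - y)) ^ 2 + lam * l1Norm β - q βk
    - dotp (g βk) (β - βk) + (sigma / 2) * (euclNorm (β - βk)) ^ 2

/-- A convex function lies above its tangent hyperplanes. -/
theorem ConvexOn.add_fderiv_le_of_hasFDerivAt {E : Type*} [NormedAddCommGroup E]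
    [NormedSpace ℝ E] {f : E → ℝ} {f' : E →L[ℝ] ℝ} {x : E}
    (hf : ConvexOn ℝ Set.univ f) (hf' : HasFDerivAt f f' x) (y : E) :
    f x + f' (y - x) ≤ f y := by
  have hline : ConvexOn ℝ Set.univ (f ∘ AffineMap.lineMap (k := ℝ) x y) := by
    simpa using hf.comp_affineMap (AffineMap.lineMap (k := ℝ) x y)
  have hderiv : HasDerivAt (f ∘ AffineMap.lineMap (k := ℝ) x y) (f' (y - x)) 0 :=
    HasFDerivAt.comp_hasDerivAt (0 : ℝ) (by simpa using hf') AffineMap.hasDerivAt_lineMap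
  have hslope := hline.le_slope_of_hasDerivAt (Set.mem_univ 0) (Set.mem_univ 1) one_pos hderiv
  simp only [slope_def_field, Function.comp_apply, AffineMap.lineMap_apply_zero,
    AffineMap.lineMap_apply_one, sub_zero, div_one] at hslope
  linarith

theorem dotCLM_apply {m : ℕ} (g v : Fin m → ℝ) : dotCLM g v = dotp g v := by
  simp [dotCLM, dotp]

theorem euclNorm_nonneg {m : ℕ} (x : Fin m → ℝ) : 0 ≤ euclNorm x := Real.sqrt_nonneg _

theorem euclNorm_neg {m : ℕ} (x : Fin m → ℝ) : euclNorm (-x) = euclNorm x := by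
  simp [euclNorm]

theorem dotp_neg_left {m : ℕ} (x y : Fin m → ℝ) : dotp (-x) y = -dotp x y := by
  simp [dotp]

/-- The Cauchy–Schwarz inequality. -/
theorem dotp_le_euclNorm_mul_euclNorm {m : ℕ} (x y : Fin m → ℝ) :
    dotp x y ≤ euclNorm x * euclNorm y :=
  Real.sum_mul_le_sqrt_mul_sqrt _ _ _

theorem neg_euclNorm_mul_euclNorm_le_dotp {m : ℕ} (x y : Fin m → ℝ) :
    -(euclNorm x * euclNorm y) ≤ dotp x y := by
  have h := dotp_le_euclNorm_mul_euclNorm (-x) y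
  rw [euclNorm_neg, dotp_neg_left] at h
  linarith

/-- The majorization exceeds the objective by at least the proximal term. -/
theorem fObj_add_le_Jmaj {n p : ℕ} (X : Matrix (Fin n) (Fin p) ℝ) (y : Fin n → ℝ)
    (lam sigma : ℝ) {q : (Fin p → ℝ) → ℝ} {g : (Fin p → ℝ) → (Fin p → ℝ)} {b : Fin p → ℝ}
    (hq : ConvexOn ℝ Set.univ q) (hg : HasFDerivAt q (dotCLM (g b)) b) (c : Fin p → ℝ) :
    fObj X y lam q c + (sigma / 2) * (euclNorm (c - b)) ^ 2 ≤ Jmaj X y lam sigma q g b c := by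
  have h := hq.add_fderiv_le_of_hasFDerivAt hg c
  rw [dotCLM_apply] at h
  unfold fObj Jmaj
  linarith

theorem Jmaj_self {n p : ℕ} (X : Matrix (Fin n) (Fin p) ℝ) (y : Fin n → ℝ)
    (lam sigma : ℝ) (q : (Fin p → ℝ) → ℝ) (g : (Fin p → ℝ) → (Fin p → ℝ)) (b : Fin p → ℝ) :
    Jmaj X y lam sigma q g b b = fObj X y lam q b := by
  simp [Jmaj, fObj, dotp, euclNorm]

/-- along the PMM iterations,
`f(β^k) ≥ f(β^{k+1}) + (σ^{2,k}/4)‖β^{k+1} − β^k‖²` for every `k`. -/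
theorem pmm_sufficient_decrease {n p : ℕ} (lam : ℝ) (hlam : 0 < lam)
    (X : Matrix (Fin n) (Fin p) ℝ) (y : Fin n → ℝ)
    (q : (Fin p → ℝ) → ℝ) (g : (Fin p → ℝ) → (Fin p → ℝ))
    (hqconv : ConvexOn ℝ Set.univ q)
    (hqdiff : ∀ β : Fin p → ℝ, HasFDerivAt q (dotCLM (g β)) β)
    (hbdd : ∃ c : ℝ, ∀ β : Fin p → ℝ, c ≤ fObj X y lam q β)
    (σ2 : ℕ → ℝ) (hσ2 : ∀ k, 0 < σ2 k)
    (β : ℕ → Fin p → ℝ) (δ : ℕ → Fin p → ℝ)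
    (hmin : ∀ k, ∀ b : Fin p → ℝ,
      Jmaj X y lam (σ2 k) q g (β k) (β (k + 1)) + dotp (δ k) (β (k + 1) - β k)
        ≤ Jmaj X y lam (σ2 k) q g (β k) b + dotp (δ k) (b - β k))
    (hδ : ∀ k, euclNorm (δ k) ≤ (σ2 k / 4) * euclNorm (β (k + 1) - β k)) :
    ∀ k, fObj X y lam q (β k)
      ≥ fObj X y lam q (β (k + 1)) + (σ2 k / 4) * (euclNorm (β (k + 1) - β k)) ^ 2 := by
  intro k
  have hmaj := fObj_add_le_Jmaj X y lam (σ2 k) hqconv (hqdiff (β k)) (β (k + 1))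
  have hstep := hmin k (β k)
  have hself : dotp (δ k) (β k - β k) = 0 := by simp [dotp]
  rw [Jmaj_self, hself] at hstep
  have hcs := neg_euclNorm_mul_euclNorm_le_dotp (δ k) (β (k + 1) - β k)
  have herr := mul_le_mul_of_nonneg_right (hδ k) (euclNorm_nonneg (β (k + 1) - β k))
  linarith
end

section
/- Let X ∈ ℝ^{n×p}, y ∈ ℝⁿ, λ > 0, and let q: ℝ^p → ℝ be convex and continuously differentiable. Let (σ^{2,k})_{k≥0} be positive reals converging to σ^{2,∞} ≥ 0, and let (β^k)_{k≥0}, (δ^k)_{k≥0} in ℝ^p be such that for every k, β^{k+1} is a global minimizer of β ↦ J_k(β) + ⟨δ^k, β − β^k⟩, where J_k(β) = (1/2)‖Xβ − y‖² + λ‖β‖₁ − q(β^k) − ⟨∇q(β^k), β − β^k⟩ + (σ^{2,k}/2)‖β − β^k‖², and ‖δ^k‖ ≤ (σ^{2,k}/4)‖β^{k+1} − β^k‖. Suppose there is a subsequence (k_j) and a point β^∞ ∈ ℝ^p such that β^{k_j} → β^∞ and β^{k_j+1} → β^∞. Then β^∞ is a global minimizer over ℝ^p of β ↦ (1/2)‖Xβ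 − y‖² + λ‖β‖₁ − q(β^∞) − ⟨∇q(β^∞), β − β^∞⟩ + (σ^{2,∞}/2)‖β − β^∞‖². -/
open Filter Topology

theorem continuous_euclNorm {m : ℕ} : Continuous (euclNorm (m := m)) := by
  unfold euclNorm
  fun_prop

theorem abs_le_euclNorm {m : ℕ} (x : Fin m → ℝ) (i : Fin m) : |x i| ≤ euclNorm x :=
  Real.abs_le_sqrt (Finset.single_le_sum (f := fun i => x i ^ 2)
    (fun i _ => sq_nonneg (x i)) (Finset.mem_univ i))

theorem continuous_l1Norm {m : ℕ} : Continuous (l1Norm (m := m)) := by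
  unfold l1Norm
  fun_prop

theorem continuous_dotp {m : ℕ} :
    Continuous (fun z : (Fin m → ℝ) × (Fin m → ℝ) => dotp z.1 z.2) := by
  unfold dotp
  fun_prop

/-- The majorization is jointly continuous in `σ`, the base point and the argument. -/
theorem continuous_Jmaj {n p : ℕ} (X : Matrix (Fin n) (Fin p) ℝ) (y : Fin n → ℝ) (lam : ℝ)
    {q : (Fin p → ℝ) → ℝ} {g : (Fin p → ℝ) → (Fin p → ℝ)}
    (hq : Continuous q) (hg : Continuous g) :
    Continuous (fun z : ℝ × (Fin p → ℝ) × (Fin p → ℝ) =>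
      Jmaj X y lam z.1 q g z.2.1 z.2.2) := by
  have hX : Continuous (fun b : Fin p → ℝ => X.mulVec b) :=
    Continuous.matrix_mulVec continuous_const continuous_id
  have hbase : Continuous (fun z : ℝ × (Fin p → ℝ) × (Fin p → ℝ) => z.2.1) := by fun_prop
  have harg : Continuous (fun z : ℝ × (Fin p → ℝ) × (Fin p → ℝ) => z.2.2) := by fun_prop
  have hstep := harg.sub hbase
  have hresid := continuous_euclNorm.comp ((hX.comp harg).sub (continuous_const (y := y)))
  exact ((((continuous_const.mul (hresid.pow 2)).add
    (continuous_const.mul (continuous_l1Norm.comp harg))).sub (hq.comp hbase)).sub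
    (continuous_dotp.comp ((hg.comp hbase).prodMk hstep))).add
    ((continuous_fst.div_const 2).mul ((continuous_euclNorm.comp hstep).pow 2))

/-- if along the PMM iterations a subsequence `β^{k_j} → β^∞` with
`β^{k_j+1} → β^∞`, then `β^∞` globally minimizes `β ↦ J(β; σ^{2,∞}, β^∞, ∇q(β^∞))`. -/
theorem pmm_subsequential_limit_minimizes {n p : ℕ} (lam : ℝ) (hlam : 0 < lam)
    (X : Matrix (Fin n) (Fin p) ℝ) (y : Fin n → ℝ)
    (q : (Fin p → ℝ) → ℝ) (g : (Fin p → ℝ) → (Fin p → ℝ))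
    (hqconv : ConvexOn ℝ Set.univ q)
    (hqdiff : ∀ β : Fin p → ℝ, HasFDerivAt q (dotCLM (g β)) β)
    (hgcont : Continuous g)
    (σ2 : ℕ → ℝ) (hσ2 : ∀ k, 0 < σ2 k)
    (σ2inf : ℝ) (hσ2inf : 0 ≤ σ2inf) (hσ2lim : Tendsto σ2 atTop (nhds σ2inf))
    (β : ℕ → Fin p → ℝ) (δ : ℕ → Fin p → ℝ)
    (hmin : ∀ k, ∀ b : Fin p → ℝ,
      Jmaj X y lam (σ2 k) q g (β k) (β (k + 1)) + dotp (δ k) (β (k + 1) - β k)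
        ≤ Jmaj X y lam (σ2 k) q g (β k) b + dotp (δ k) (b - β k))
    (hδ : ∀ k, euclNorm (δ k) ≤ (σ2 k / 4) * euclNorm (β (k + 1) - β k))
    (kj : ℕ → ℕ) (hkj : StrictMono kj) (βinf : Fin p → ℝ)
    (hconv1 : Tendsto (fun j => β (kj j)) atTop (nhds βinf))
    (hconv2 : Tendsto (fun j => β (kj j + 1)) atTop (nhds βinf)) :
    ∀ b : Fin p → ℝ, Jmaj X y lam σ2inf q g βinf βinf ≤ Jmaj X y lam σ2inf q g βinf b := by
  intro b
  have hq : Continuous q := continuous_iff_continuousAt.2 fun b => (hqdiff b).continuousAt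
  have hσ : Tendsto (fun j => σ2 (kj j)) atTop (𝓝 σ2inf) := hσ2lim.comp hkj.tendsto_atTop
  have hbound : Tendsto (fun j => σ2 (kj j) / 4 * euclNorm (β (kj j + 1) - β (kj j)))
      atTop (𝓝 0) := by
    have h := (hσ.div_const 4).mul
      ((continuous_euclNorm.tendsto (βinf - βinf)).comp (hconv2.sub hconv1))
    simpa [euclNorm, Function.comp_def] using h
  have hδ0 : Tendsto (fun j => δ (kj j)) atTop (𝓝 0) :=
    tendsto_pi_nhds.2 fun i => squeeze_zero_norm
      (fun j => (abs_le_euclNorm (δ (kj j)) i).trans (hδ (kj j))) hbound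
  have hlim : ∀ (u : ℕ → Fin p → ℝ) (c : Fin p → ℝ), Tendsto u atTop (𝓝 c) →
      Tendsto (fun j => Jmaj X y lam (σ2 (kj j)) q g (β (kj j)) (u j)
        + dotp (δ (kj j)) (u j - β (kj j))) atTop (𝓝 (Jmaj X y lam σ2inf q g βinf c)) := by
    intro u c hu
    have hJ := ((continuous_Jmaj X y lam hq hgcont).tendsto (σ2inf, βinf, c)).comp
      (hσ.prodMk_nhds (hconv1.prodMk_nhds hu))
    have hdot := (continuous_dotp.tendsto (0, c - βinf)).comp
      (hδ0.prodMk_nhds (hu.sub hconv1))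
    simpa [dotp, Function.comp_def] using hJ.add hdot
  exact le_of_tendsto_of_tendsto' (hlim _ _ hconv2) (hlim _ _ tendsto_const_nhds)
    fun j => hmin (kj j) b
end
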